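/- Let k ≥ 2 be an integer. There exists a unique t₀ > 0 with k·tanh(k·t₀/2) = coth(t₀/2), and for every real β with 0 < β ≤ 1 and every T > 0, the 2k-th normalized Steklov eigenvalue satisfies σ̃_{2k}(β,T) ≤ 4kπ·tanh(k·t₀/2), with equality if and only if β = 1 and T = t₀. -/

import Mathlib

open Real

/-- The hyperbolic cotangent. -/
noncomputable def coth (t : ℝ) : ℝ := Real.cosh t / Real.sinh t

/-- The normalized Steklov eigenvalues `λ̃_n(β,T)` (for `n ≥ 1`). -/
noncomputable def lamS (n : ℕ) (β T : ℝ) : ℝ :=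
  (4 * n * π / β) * (coth (n * T) - Real.sqrt ((coth (n * T)) ^ 2 - β))

/-- The normalized Steklov eigenvalues `μ̃_n(β,T)` (with `μ̃_0(β,T) = 8π/(Tβ)`). -/
noncomputable def muS (n : ℕ) (β T : ℝ) : ℝ :=
  if n = 0 then 8 * π / (T * β)
  else (4 * n * π / β) * (coth (n * T) + Real.sqrt ((coth (n * T)) ^ 2 - β))

/-- The `j`-th smallest normalized Steklov eigenvalue, counted with multiplicity:
`μ̃_0` has multiplicity one, and each `λ̃_n`, `μ̃_n` (`n ≥ 1`) has multiplicity two. -/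
noncomputable def sigmaS (β T : ℝ) (j : ℕ) : ℝ :=
  sInf { x : ℝ |
    j ≤ 2 * {n : ℕ | 1 ≤ n ∧ lamS n β T ≤ x}.ncard
      + 2 * {n : ℕ | 1 ≤ n ∧ muS n β T ≤ x}.ncard
      + (if muS 0 β T ≤ x then 1 else 0) }

theorem nonneg_of_hasDerivAt_nonneg {f f' : ℝ → ℝ} (hf : ∀ x, HasDerivAt f (f' x) x)
    (h0 : f 0 = 0) (hf' : ∀ x, 0 ≤ x → 0 ≤ f' x) {x : ℝ} (hx : 0 ≤ x) : 0 ≤ f x := by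
  have hmono : MonotoneOn f (Set.Ici 0) :=
    monotoneOn_of_hasDerivWithinAt_nonneg (convex_Ici 0)
      (fun y _ => (hf y).continuousAt.continuousWithinAt)
      (fun y _ => (hf y).hasDerivWithinAt)
      (fun y hy => hf' y (by rw [interior_Ici] at hy; exact le_of_lt hy))
  simpa [h0] using hmono (Set.mem_Ici.2 le_rfl) (Set.mem_Ici.2 hx) hx

theorem sinh_le_mul_cosh {x : ℝ} (hx : 0 ≤ x) : 0 ≤ x * cosh x - sinh x := by
  refine nonneg_of_hasDerivAt_nonneg (f := fun x => x * cosh x - sinh x)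
    (f' := fun x => x * sinh x) (fun x => ?_) (by simp)
    (fun x hx => mul_nonneg hx (sinh_nonneg_iff.2 hx)) hx
  refine HasDerivAt.congr_deriv (((hasDerivAt_id' x).mul (hasDerivAt_cosh x)).sub (hasDerivAt_sinh x)) ?_
  ring

theorem two_mul_cosh_sub_one_le {x : ℝ} (hx : 0 ≤ x) : 0 ≤ x * sinh x - 2 * (cosh x - 1) := by
  refine nonneg_of_hasDerivAt_nonneg (f := fun x => x * sinh x - 2 * (cosh x - 1))
    (f' := fun x => x * cosh x - sinh x) (fun x => ?_) (by simp)
    (fun x hx => sinh_le_mul_cosh hx) hx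
  refine HasDerivAt.congr_deriv (((hasDerivAt_id' x).mul (hasDerivAt_sinh x)).sub
    (((hasDerivAt_cosh x).sub_const 1).const_mul 2)) ?_
  ring

/-- The hyperbolic Cusa inequality. -/
theorem three_mul_sinh_le {x : ℝ} (hx : 0 ≤ x) : 0 ≤ 2 * x + x * cosh x - 3 * sinh x := by
  refine nonneg_of_hasDerivAt_nonneg (f := fun x => 2 * x + x * cosh x - 3 * sinh x)
    (f' := fun x => x * sinh x - 2 * (cosh x - 1)) (fun x => ?_) (by simp)
    (fun x hx => two_mul_cosh_sub_one_le hx) hx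
  refine HasDerivAt.congr_deriv ((((hasDerivAt_id' x).const_mul 2).add
    ((hasDerivAt_id' x).mul (hasDerivAt_cosh x))).sub ((hasDerivAt_sinh x).const_mul 3)) ?_
  ring

theorem four_mul_cosh_sub_one_le {x : ℝ} (hx : 0 ≤ x) :
    0 ≤ x ^ 2 + x * sinh x - 4 * (cosh x - 1) := by
  refine nonneg_of_hasDerivAt_nonneg (f := fun x => x ^ 2 + x * sinh x - 4 * (cosh x - 1))
    (f' := fun x => 2 * x + x * cosh x - 3 * sinh x) (fun x => ?_) (by simp)
    (fun x hx => three_mul_sinh_le hx) hx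
  refine HasDerivAt.congr_deriv ((((hasDerivAt_id' x).fun_pow 2).add
    ((hasDerivAt_id' x).mul (hasDerivAt_sinh x))).sub
    (((hasDerivAt_cosh x).sub_const 1).const_mul 4)) ?_
  push_cast
  ring

theorem two_mul_sinh_sq_le {x : ℝ} (hx : 0 ≤ x) :
    2 * sinh x ^ 2 ≤ x ^ 2 + x * sinh x * cosh x := by
  have h := four_mul_cosh_sub_one_le (x := 2 * x) (by positivity)
  rw [cosh_two_mul, sinh_two_mul, cosh_sq] at h
  nlinarith

/-- The quotient of the derivatives of `sinh x / x` and of `cosh x`. -/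
theorem antitoneOn_sinhc_deriv_div_sinh :
    AntitoneOn (fun x : ℝ => (x * cosh x - sinh x) / (x ^ 2 * sinh x)) (Set.Ioi 0) := by
  have hd : ∀ x : ℝ, 0 < x → HasDerivAt (fun x : ℝ => (x * cosh x - sinh x) / (x ^ 2 * sinh x))
      ((2 * sinh x ^ 2 - (x ^ 2 + x * sinh x * cosh x)) / (x ^ 3 * sinh x ^ 2)) x := by
    intro x hx
    have hs : 0 < sinh x := sinh_pos_iff.2 hx
    refine HasDerivAt.congr_deriv ((((hasDerivAt_id' x).mul (hasDerivAt_cosh x)).sub (hasDerivAt_sinh x)).div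
      (((hasDerivAt_id' x).fun_pow 2).mul (hasDerivAt_sinh x)) (by positivity)) ?_
    have := cosh_sq x
    simp only [Pi.sub_apply, Pi.mul_apply]
    push_cast
    field_simp
    grind
  refine antitoneOn_of_hasDerivWithinAt_nonpos (convex_Ioi 0)
    (fun x hx => (hd x hx).continuousAt.continuousWithinAt)
    (fun x hx => (hd x (by simpa using hx)).hasDerivWithinAt) (fun x hx => ?_)
  have hx' : 0 < x := by simpa using hx
  exact div_nonpos_of_nonpos_of_nonneg (sub_nonpos.2 (two_mul_sinh_sq_le hx'.le)) (by positivity)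

/-- As a function of `cosh x`, the function `sinh x / x` lies below its tangents. -/
theorem sinhc_sub_le {y z : ℝ} (hy : 0 < y) (hz : 0 < z) :
    sinh z / z - sinh y / y ≤
      (y * cosh y - sinh y) / (y ^ 2 * sinh y) * (cosh z - cosh y) := by
  set r : ℝ → ℝ := fun x => (x * cosh x - sinh x) / (x ^ 2 * sinh x) with hr
  set f : ℝ → ℝ := fun x => r y * cosh x - sinh x / x with hf
  have hd : ∀ x : ℝ, 0 < x → HasDerivAt f (sinh x * (r y - r x)) x := by
    intro x hx
    have hs : 0 < sinh x := sinh_pos_iff.2 hx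
    refine HasDerivAt.congr_deriv (((hasDerivAt_cosh x).const_mul (r y)).sub
      ((hasDerivAt_sinh x).div (hasDerivAt_id' x) hx.ne')) ?_
    have hrx : r x * (x ^ 2 * sinh x) = x * cosh x - sinh x :=
      div_mul_cancel₀ _ (by positivity)
    field_simp
    linarith
  have key : f y ≤ f z := by
    rcases le_total y z with h | h
    · have hm : MonotoneOn f (Set.Icc y z) := by
        refine monotoneOn_of_hasDerivWithinAt_nonneg (convex_Icc y z)
          (fun x hx => (hd x (hy.trans_le hx.1)).continuousAt.continuousWithinAt)
          (fun x hx => (hd x ?_).hasDerivWithinAt) (fun x hx => ?_)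
        · rw [interior_Icc] at hx
          exact hy.trans hx.1
        · rw [interior_Icc] at hx
          have hx0 : 0 < x := hy.trans hx.1
          exact mul_nonneg (sinh_nonneg_iff.2 hx0.le)
            (sub_nonneg.2 (antitoneOn_sinhc_deriv_div_sinh hy hx0 hx.1.le))
      exact hm ⟨le_rfl, h⟩ ⟨h, le_rfl⟩ h
    · have hm : AntitoneOn f (Set.Icc z y) := by
        refine antitoneOn_of_hasDerivWithinAt_nonpos (convex_Icc z y)
          (fun x hx => (hd x (hz.trans_le hx.1)).continuousAt.continuousWithinAt)
          (fun x hx => (hd x ?_).hasDerivWithinAt) (fun x hx => ?_)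
        · rw [interior_Icc] at hx
          exact hz.trans hx.1
        · rw [interior_Icc] at hx
          have hx0 : 0 < x := hz.trans hx.1
          exact mul_nonpos_of_nonneg_of_nonpos (sinh_nonneg_iff.2 hx0.le)
            (sub_nonpos.2 (antitoneOn_sinhc_deriv_div_sinh hx0 hy hx.2.le))
      exact hm ⟨le_rfl, h⟩ ⟨h, le_rfl⟩ h
  simp only [hf, hr] at key
  linarith [mul_sub ((y * cosh y - sinh y) / (y ^ 2 * sinh y)) (cosh z) (cosh y)]

/-- The slopes of `sinh x / x` with respect to `cosh x` over intervals with a common right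
endpoint are decreasing. -/
theorem sinhc_slope_antitone {x y z : ℝ} (hx : 0 < x) (hxy : x ≤ y) (hyz : y < z) :
    (sinh z / z - sinh y / y) * (cosh z - cosh x) ≤
      (sinh z / z - sinh x / x) * (cosh z - cosh y) := by
  have hy := hx.trans_le hxy
  have h1 := sinhc_sub_le hy (hy.trans hyz)
  have h2 := sinhc_sub_le hy hx
  have h3 : 0 ≤ cosh y - cosh x :=
    sub_nonneg.2 (cosh_le_cosh.2 (by rwa [abs_of_pos hx, abs_of_pos hy]))
  have h4 : 0 ≤ cosh z - cosh y :=
    sub_nonneg.2 (cosh_le_cosh.2 (by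
      rw [abs_of_pos hy, abs_of_pos (hy.trans hyz)]; exact hyz.le))
  nlinarith [mul_le_mul_of_nonneg_right h1 h3, mul_le_mul_of_nonneg_right h2 h4]

theorem one_lt_coth {x : ℝ} (hx : 0 < x) : 1 < coth x :=
  (one_lt_div (sinh_pos_iff.2 hx)).2 (sinh_lt_cosh x)

theorem hasDerivAt_coth {x : ℝ} (hx : 0 < x) : HasDerivAt coth (-(1 / sinh x ^ 2)) x := by
  have hs : 0 < sinh x := sinh_pos_iff.2 hx
  refine HasDerivAt.congr_deriv ((hasDerivAt_cosh x).div (hasDerivAt_sinh x) hs.ne') ?_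
  have := cosh_sq x
  field_simp
  linarith

theorem two_mul_coth_mul_tanh_half {x : ℝ} (hx : 0 < x) :
    2 * coth x * tanh (x / 2) = 1 + tanh (x / 2) ^ 2 := by
  have hs : 0 < sinh (x / 2) := sinh_pos_iff.2 (by positivity)
  have hc := cosh_pos (x / 2)
  have h : coth x = coth (2 * (x / 2)) := by ring_nf
  rw [h, coth, cosh_two_mul, sinh_two_mul, tanh_eq_sinh_div_cosh]
  field_simp

theorem two_mul_coth_mul_coth_half {x : ℝ} (hx : 0 < x) :
    2 * coth x * coth (x / 2) = 1 + coth (x / 2) ^ 2 := by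
  have hs : 0 < sinh (x / 2) := sinh_pos_iff.2 (by positivity)
  have hc := cosh_pos (x / 2)
  have h : coth x = coth (2 * (x / 2)) := by ring_nf
  rw [h, coth, cosh_two_mul, sinh_two_mul, coth]
  field_simp
  ring

theorem mul_sinh_lt_sinh_mul {k : ℕ} (hk : 2 ≤ k) {x : ℝ} (hx : 0 < x) :
    k * sinh x < sinh (k * x) := by
  have hs : 0 < sinh x := sinh_pos_iff.2 hx
  have hc : 1 < cosh x := one_lt_cosh.2 hx.ne'
  induction k, hk using Nat.le_induction with
  | base =>
    push_cast
    rw [sinh_two_mul]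
    nlinarith
  | succ n hn ih =>
    have hn0 : (0 : ℝ) < n := by exact_mod_cast (by omega : 0 < n)
    have h1 : 0 < sinh (n * x) := sinh_pos_iff.2 (by positivity)
    have h2 := one_le_cosh (n * x)
    push_cast
    rw [add_mul _ _ x, add_mul _ _ (sinh x), one_mul, one_mul, sinh_add]
    nlinarith

theorem sinh_mul_mul_cosh_le (n : ℕ) {x : ℝ} (hx : 0 ≤ x) :
    sinh (n * x) * cosh x ≤ n * sinh x * cosh (n * x) := by
  have hs : 0 ≤ sinh x := sinh_nonneg_iff.2 hx
  induction n with
  | zero => simp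
  | succ n ih =>
    have h1 : 0 ≤ sinh (n * x) := sinh_nonneg_iff.2 (by positivity)
    have h2 := cosh_pos x
    push_cast
    rw [add_mul, one_mul, sinh_add, cosh_add]
    nlinarith [mul_le_mul_of_nonneg_right ih h2.le,
      mul_nonneg (mul_nonneg (by positivity : (0 : ℝ) ≤ n + 1) hs) (mul_nonneg h1 hs)]

theorem coth_le_mul_coth_mul {n : ℕ} (hn : 1 ≤ n) {x : ℝ} (hx : 0 < x) :
    coth x ≤ n * coth (n * x) := by
  have hn0 : (0 : ℝ) < n := by exact_mod_cast hn
  have hs : 0 < sinh x := sinh_pos_iff.2 hx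
  have hs' : 0 < sinh (n * x) := sinh_pos_iff.2 (by positivity)
  have h := sinh_mul_mul_cosh_le n hx.le
  rw [coth, coth, ← mul_div_assoc, div_le_div_iff₀ hs hs']
  linarith

theorem strictMonoOn_mul_coth_mul_sub_coth {k : ℕ} (hk : 2 ≤ k) :
    StrictMonoOn (fun t : ℝ => k * coth (k * t) - coth t) (Set.Ioi 0) := by
  have hk0 : (0 : ℝ) < k := by exact_mod_cast (by omega : 0 < k)
  have hd : ∀ t : ℝ, 0 < t → HasDerivAt (fun t : ℝ => k * coth (k * t) - coth t)
      (1 / sinh t ^ 2 - k ^ 2 / sinh (k * t) ^ 2) t := by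
    intro t ht
    refine HasDerivAt.congr_deriv ((((hasDerivAt_coth (by positivity : 0 < k * t)).comp t
      ((hasDerivAt_id' t).const_mul (k : ℝ))).const_mul (k : ℝ)).sub (hasDerivAt_coth ht)) ?_
    ring
  refine strictMonoOn_of_hasDerivWithinAt_pos (convex_Ioi 0)
    (fun t ht => (hd t ht).continuousAt.continuousWithinAt)
    (fun t ht => (hd t (by simpa using ht)).hasDerivWithinAt) (fun t ht => ?_)
  have ht' : 0 < t := by simpa using ht
  have hs : 0 < sinh t := sinh_pos_iff.2 ht'
  have h := mul_sinh_lt_sinh_mul hk ht'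
  have hs' : 0 < sinh (k * t) := by nlinarith
  rw [sub_pos, div_lt_div_iff₀ (by positivity) (by positivity)]
  nlinarith [mul_pos hk0 hs]

theorem mul_coth_mul_sub_coth_lt {k : ℕ} (hk : 2 ≤ k) {t : ℝ} (ht : 0 < t) :
    k * coth (k * t) - coth t < k - 1 := by
  have hk1 : (1 : ℝ) ≤ k := by exact_mod_cast (by omega : 1 ≤ k)
  have hexp : ∀ {x : ℝ}, 0 < x → coth x - 1 = exp (-x) / sinh x := by
    intro x hx
    have hs : 0 < sinh x := sinh_pos_iff.2 hx
    rw [coth, ← cosh_sub_sinh]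
    field_simp
  have hs : 0 < sinh t := sinh_pos_iff.2 ht
  have h := mul_sinh_lt_sinh_mul hk ht
  have hs' : 0 < sinh (k * t) := by nlinarith
  have h1 := hexp ht
  have h2 := hexp (by positivity : 0 < k * t)
  have h3 : exp (-(k * t)) ≤ exp (-t) := exp_le_exp.2 (by nlinarith)
  have h4 : k * (coth (k * t) - 1) < coth t - 1 := by
    rw [h1, h2, ← mul_div_assoc, div_lt_div_iff₀ hs' hs]
    nlinarith [exp_pos (-t), exp_pos (-(k * t))]
  linarith

theorem mul_coth_sub_mul_coth {a b : ℝ} {t : ℝ} (ht : 0 < t) (hb : 0 < b) (hab : b < a) :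
    (a * coth (a * t) - b * coth (b * t)) * (cosh ((a + b) * t) - cosh ((a - b) * t)) =
      (a - b) * (a + b) * t *
        (sinh ((a + b) * t) / ((a + b) * t) - sinh ((a - b) * t) / ((a - b) * t)) := by
  have ha : 0 < a := hb.trans hab
  have hsa : 0 < sinh (a * t) := sinh_pos_iff.2 (by positivity)
  have hsb : 0 < sinh (b * t) := sinh_pos_iff.2 (by positivity)
  have hs : 0 < a + b := by positivity
  have hd : 0 < a - b := sub_pos.2 hab
  have h1 : (a - b) * (a + b) * t *
        (sinh ((a + b) * t) / ((a + b) * t) - sinh ((a - b) * t) / ((a - b) * t)) =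
      (a - b) * sinh ((a + b) * t) - (a + b) * sinh ((a - b) * t) := by
    field_simp
  rw [h1, add_mul a b t, sub_mul a b t, sinh_add, sinh_sub, cosh_add, cosh_sub, coth, coth]
  field_simp
  ring

/-- For fixed `a + b`, the slopes of `x ↦ x coth (x t)` between `b` and `a` decrease in `a - b`. -/
theorem mul_coth_slope_le {a b c d t : ℝ} (ht : 0 < t) (hb : 0 < b) (hbd : b ≤ d) (hdc : d < c)
    (hsum : c + d = a + b) :
    (c - d) * (a * coth (a * t) - b * coth (b * t)) ≤
      (a - b) * (c * coth (c * t) - d * coth (d * t)) := by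
  have hca : c ≤ a := by linarith
  have h1 := mul_coth_sub_mul_coth ht hb (by linarith : b < a)
  have h2 := mul_coth_sub_mul_coth ht (hb.trans_le hbd) hdc
  rw [hsum] at h2
  set Y := (a + b) * t
  have hyp : 0 < (c - d) * t := mul_pos (by linarith) ht
  have hyz : (c - d) * t ≤ (a - b) * t := by nlinarith
  have hzY : (a - b) * t < (a + b) * t := by nlinarith
  have h3 := sinhc_slope_antitone hyp hyz hzY
  have hA : 0 < cosh Y - cosh ((a - b) * t) :=
    sub_pos.2 (cosh_lt_cosh.2 (by
      rw [abs_of_pos (hyp.trans_le hyz), abs_of_pos (hyp.trans (hyz.trans_lt hzY))]; exact hzY))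
  have hC : 0 < cosh Y - cosh ((c - d) * t) :=
    sub_pos.2 (cosh_lt_cosh.2 (by
      rw [abs_of_pos hyp, abs_of_pos (hyp.trans (hyz.trans_lt hzY))]; exact hyz.trans_lt hzY))
  rw [← eq_div_iff hA.ne'] at h1
  rw [← eq_div_iff hC.ne'] at h2
  rw [h1, h2, ← mul_div_assoc, ← mul_div_assoc, div_le_div_iff₀ hA hC]
  have hpos : 0 ≤ (c - d) * (a - b) * (a + b) * t := by
    have : 0 < c - d := by linarith
    have : 0 < a - b := by linarith
    have : 0 < a + b := by linarith
    positivity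
  linarith [mul_le_mul_of_nonneg_left h3 hpos]

theorem tanh_half_pos {x : ℝ} (hx : 0 < x) : 0 < tanh (x / 2) := by
  rw [tanh_eq_sinh_div_cosh]
  exact div_pos (sinh_pos_iff.2 (by positivity)) (cosh_pos _)

theorem coth_sub_sqrt_lt {c β : ℝ} (hc : 1 < c) (hβ : 0 < β) (hβ1 : β ≤ 1) :
    c - sqrt (c ^ 2 - β) < β := by
  have : c - β < sqrt (c ^ 2 - β) := lt_sqrt_of_sq_lt (by nlinarith)
  linarith

theorem coth_sub_sqrt_pos {c β : ℝ} (hc : 1 < c) (hβ : 0 < β) :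
    0 < c - sqrt (c ^ 2 - β) :=
  sub_pos.2 ((sqrt_lt' (by linarith)).2 (by linarith))

theorem lamS_le_muS {n : ℕ} (hn : 1 ≤ n) {β T : ℝ} (hβ : 0 < β) : lamS n β T ≤ muS n β T := by
  rw [lamS, muS, if_neg (by omega)]
  have := sqrt_nonneg (coth (n * T) ^ 2 - β)
  gcongr
  linarith

theorem mul_pi_div_coth_le_lamS {n : ℕ} (hn : 1 ≤ n) {β T : ℝ} (hβ : 0 < β) (hβ1 : β ≤ 1)
    (hT : 0 < T) : 2 * n * π / coth T ≤ lamS n β T := by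
  have hn1 : (1 : ℝ) ≤ n := by exact_mod_cast hn
  have hc := one_lt_coth (by positivity : 0 < n * T)
  have hc1 := one_lt_coth hT
  have hle : coth (n * T) ≤ coth T := by
    refine (antitoneOn_of_hasDerivWithinAt_nonpos (f' := fun x => -(1 / sinh x ^ 2))
      (convex_Ioi 0) (fun x hx => (hasDerivAt_coth hx).continuousAt.continuousWithinAt)
      (fun x hx => (hasDerivAt_coth (by simpa using hx)).hasDerivWithinAt)
      (fun x _ => ?_)) hT (by positivity : (0 : ℝ) < n * T) (by nlinarith)
    simp only [Left.neg_nonpos_iff]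
    positivity
  have hsq : coth (n * T) ^ 2 - β ≥ 0 := by nlinarith
  have h1 := sq_sqrt hsq
  have h2 := sqrt_nonneg (coth (n * T) ^ 2 - β)
  have h3 := coth_sub_sqrt_pos hc hβ
  set c := coth (n * T)
  set s := sqrt (c ^ 2 - β)
  have h4 : β ≤ 2 * coth T * (c - s) := by
    have : β = (c + s) * (c - s) := by linarith
    rw [this]
    gcongr
    linarith
  have h5 : lamS n β T = 4 * n * π / β * (c - s) := rfl
  rw [h5, div_mul_eq_mul_div, div_le_div_iff₀ (by positivity) hβ]
  have : 0 < n * π := mul_pos (by linarith) pi_pos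
  nlinarith

theorem lamS_lt_four_mul_pi_mul {n : ℕ} (hn : 1 ≤ n) {β T : ℝ} (hβ : 0 < β) (hβ1 : β ≤ 1)
    (hT : 0 < T) : lamS n β T < 4 * π * n := by
  have hn0 : (0 : ℝ) < n := by exact_mod_cast hn
  have h := coth_sub_sqrt_lt (one_lt_coth (by positivity : 0 < n * T)) hβ hβ1
  rw [lamS, div_mul_eq_mul_div, div_lt_iff₀ hβ]
  have : 0 < n * π := mul_pos hn0 pi_pos
  nlinarith

theorem quadratic_nonneg_of_le_lamS {n : ℕ} (hn : 1 ≤ n) {β T m : ℝ} (hβ : 0 < β) (hβ1 : β ≤ 1)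
    (hT : 0 < T) (h : 4 * π * m ≤ lamS n β T) :
    0 ≤ β * m ^ 2 - 2 * m * (n * coth (n * T)) + (n : ℝ) ^ 2 := by
  have hn0 : (0 : ℝ) < n := by exact_mod_cast hn
  have hc := one_lt_coth (by positivity : 0 < n * T)
  have hsq : coth (n * T) ^ 2 - β ≥ 0 := by nlinarith
  have h1 := sq_sqrt hsq
  have h2 := sqrt_nonneg (coth (n * T) ^ 2 - β)
  rw [lamS, div_mul_eq_mul_div, le_div_iff₀ hβ] at h
  set c := coth (n * T)
  set s := sqrt (c ^ 2 - β)
  have h3 : β * m ≤ n * (c - s) := by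
    have : 4 * π * (β * m) ≤ 4 * π * (n * (c - s)) := by linarith
    exact le_of_mul_le_mul_left this (by positivity)
  have h4 : (n * s) ^ 2 ≤ (n * c - β * m) ^ 2 := by
    gcongr
    linarith
  have h5 : 0 ≤ β * (β * m ^ 2 - 2 * m * (n * c) + (n : ℝ) ^ 2) := by
    nlinarith
  exact nonneg_of_mul_nonneg_right h5 hβ

theorem muS_lt_of_quadratic_pos {n : ℕ} (hn : 1 ≤ n) {β T m : ℝ} (hβ : 0 < β) (hβ1 : β ≤ 1)
    (hT : 0 < T) (hm : n ≤ m)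
    (h : 0 < β * m ^ 2 - 2 * m * (n * coth (n * T)) + (n : ℝ) ^ 2) :
    muS n β T < 4 * π * m := by
  have hn0 : (0 : ℝ) < n := by exact_mod_cast hn
  have hc := one_lt_coth (by positivity : 0 < n * T)
  have hsq : coth (n * T) ^ 2 - β ≥ 0 := by nlinarith
  have h1 := sq_sqrt hsq
  have h2 := sqrt_nonneg (coth (n * T) ^ 2 - β)
  have h3 := coth_sub_sqrt_lt hc hβ hβ1
  rw [muS, if_neg (by omega), div_mul_eq_mul_div, div_lt_iff₀ hβ]
  set c := coth (n * T)
  set s := sqrt (c ^ 2 - β)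
  have h4 : (n * s) ^ 2 < (β * m - n * c) ^ 2 := by nlinarith
  have h5 : n * s < |β * m - n * c| := by
    rw [← abs_of_nonneg (by positivity : 0 ≤ n * s)]
    exact sq_lt_sq.1 h4
  have h6 : n * s < β * m - n * c := by
    rcases lt_abs.1 h5 with h6 | h6
    · exact h6
    · nlinarith
  nlinarith [pi_pos]

theorem lamS_one {n : ℕ} (hn : 1 ≤ n) {T : ℝ} (hT : 0 < T) :
    lamS n 1 T = 4 * n * π * tanh (n * T / 2) := by
  have hn0 : (0 : ℝ) < n := by exact_mod_cast hn
  have hx : 0 < n * T := by positivity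
  have ht : 0 < tanh (n * T / 2) := tanh_half_pos hx
  have h := two_mul_coth_mul_tanh_half hx
  have h2 := one_lt_coth hx
  have h3 : tanh (n * T / 2) < 1 := tanh_lt_one _
  set c := coth (n * T)
  set t := tanh (n * T / 2)
  have h4 : sqrt (c ^ 2 - 1) = c - t := by
    rw [show c ^ 2 - 1 = (c - t) ^ 2 by linarith]
    exact sqrt_sq (by linarith)
  have h5 : lamS n 1 T = 4 * n * π / 1 * (c - sqrt (c ^ 2 - 1)) := rfl
  rw [h5, h4]
  ring

theorem lamS_lt_of_lt_one {n : ℕ} (hn : 1 ≤ n) {β T : ℝ} (hβ : 0 < β) (hβ1 : β < 1)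
    (hT : 0 < T) : lamS n β T < 4 * n * π * tanh (n * T / 2) := by
  have hn0 : (0 : ℝ) < n := by exact_mod_cast hn
  have hx : 0 < n * T := by positivity
  have ht : 0 < tanh (n * T / 2) := tanh_half_pos hx
  have h := two_mul_coth_mul_tanh_half hx
  rw [lamS, div_mul_eq_mul_div, div_lt_iff₀ hβ]
  set c := coth (n * T)
  set t := tanh (n * T / 2)
  have h4 : c - β * t < sqrt (c ^ 2 - β) := by
    apply lt_sqrt_of_sq_lt
    have : β * (β * t ^ 2) < β * t ^ 2 := by
      have : 0 < β * t ^ 2 := by positivity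
      nlinarith
    nlinarith
  have : 0 < n * π := mul_pos hn0 pi_pos
  nlinarith

theorem muS_one {n : ℕ} (hn : 1 ≤ n) {T : ℝ} (hT : 0 < T) :
    muS n 1 T = 4 * n * π * coth (n * T / 2) := by
  have hn0 : (0 : ℝ) < n := by exact_mod_cast hn
  have hx : 0 < n * T := by positivity
  have h := two_mul_coth_mul_coth_half hx
  have h2 := one_lt_coth hx
  have h3 := one_lt_coth (by positivity : 0 < n * T / 2)
  rw [muS, if_neg (by omega)]
  set c := coth (n * T)
  set t := coth (n * T / 2)
  have h4 : sqrt (c ^ 2 - 1) = t - c := by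
    rw [show c ^ 2 - 1 = (t - c) ^ 2 by linarith]
    exact sqrt_sq (by nlinarith)
  rw [h4]
  ring

theorem finite_lamS_le {β T : ℝ} (hβ : 0 < β) (hβ1 : β ≤ 1) (hT : 0 < T) (x : ℝ) :
    {n : ℕ | 1 ≤ n ∧ lamS n β T ≤ x}.Finite := by
  refine (Set.finite_Iic ⌊x * coth T / (2 * π)⌋₊).subset fun n hn => Nat.le_floor ?_
  have h := (mul_pi_div_coth_le_lamS hn.1 hβ hβ1 hT).trans hn.2
  rw [div_le_iff₀ (by linarith [one_lt_coth hT])] at h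
  rw [le_div_iff₀ (by positivity)]
  linarith

theorem finite_muS_le {β T : ℝ} (hβ : 0 < β) (hβ1 : β ≤ 1) (hT : 0 < T) (x : ℝ) :
    {n : ℕ | 1 ≤ n ∧ muS n β T ≤ x}.Finite :=
  (finite_lamS_le hβ hβ1 hT x).subset fun _ hn => ⟨hn.1, (lamS_le_muS hn.1 hβ).trans hn.2⟩

theorem sigmaS_le {k : ℕ} (hk : 1 ≤ k) {β T x : ℝ} (hβ : 0 < β) (hβ1 : β ≤ 1) (hT : 0 < T)
    (h : ∀ n ∈ Finset.Icc 1 k, lamS n β T ≤ x ∨ muS (k + 1 - n) β T ≤ x) :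
    sigmaS β T (2 * k) ≤ x := by
  have hlam : ∀ n : ℕ, 1 ≤ n → 0 ≤ lamS n β T := fun n hn =>
    le_trans (div_nonneg (by positivity) (by linarith [one_lt_coth hT]))
      (mul_pi_div_coth_le_lamS hn hβ hβ1 hT)
  refine csInf_le ⟨0, fun y hy => ?_⟩ ?_
  · by_contra! hy0
    have h1 : {n : ℕ | 1 ≤ n ∧ lamS n β T ≤ y} = ∅ :=
      Set.eq_empty_of_forall_notMem fun n hn => by linarith [hlam n hn.1, hn.2]
    have h2 : {n : ℕ | 1 ≤ n ∧ muS n β T ≤ y} = ∅ :=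
      Set.eq_empty_of_forall_notMem fun n hn => by
        linarith [hlam n hn.1, hn.2, lamS_le_muS (T := T) hn.1 hβ]
    have h3 : ¬ muS 0 β T ≤ y := by
      rw [muS, if_pos rfl, not_le]
      exact hy0.trans (by positivity)
    rw [Set.mem_ofPred_eq, h1, h2, if_neg h3] at hy
    simp at hy
    omega
  · classical
    have hA : ((Finset.Icc 1 k).filter fun n => lamS n β T ≤ x).card ≤
        {n : ℕ | 1 ≤ n ∧ lamS n β T ≤ x}.ncard := by
      rw [← Set.ncard_coe_finset]
      refine Set.ncard_le_ncard (fun n hn => ?_) (finite_lamS_le hβ hβ1 hT x)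
      rw [Finset.mem_coe, Finset.mem_filter, Finset.mem_Icc] at hn
      exact ⟨hn.1.1, hn.2⟩
    have hB : ((Finset.Icc 1 k).filter fun n => ¬ lamS n β T ≤ x).card ≤
        {n : ℕ | 1 ≤ n ∧ muS n β T ≤ x}.ncard := by
      rw [← Set.ncard_coe_finset]
      refine Set.ncard_le_ncard_of_injOn (fun n => k + 1 - n) (fun n hn => ?_)
        (fun n hn n' hn' hnn => ?_) (finite_muS_le hβ hβ1 hT x)
      · rw [Finset.mem_coe, Finset.mem_filter] at hn
        have := Finset.mem_Icc.1 hn.1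
        exact ⟨by omega, (h n hn.1).resolve_left hn.2⟩
      · rw [Finset.mem_coe, Finset.mem_filter, Finset.mem_Icc] at hn hn'
        simp only at hnn
        omega
    have hsum := Finset.card_filter_add_card_filter_not (s := Finset.Icc 1 k)
      (fun n => lamS n β T ≤ x)
    rw [Nat.card_Icc] at hsum
    rw [Set.mem_ofPred_eq]
    omega

theorem sigmaS_lt {k : ℕ} (hk : 1 ≤ k) {β T x : ℝ} (hβ : 0 < β) (hβ1 : β ≤ 1) (hT : 0 < T)
    (h : ∀ n ∈ Finset.Icc 1 k, lamS n β T < x ∨ muS (k + 1 - n) β T < x) :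
    sigmaS β T (2 * k) < x := by
  have hne : (Finset.Icc 1 k).Nonempty := ⟨1, by simp [hk]⟩
  set f : ℕ → ℝ := fun n => min (lamS n β T) (muS (k + 1 - n) β T)
  refine lt_of_le_of_lt (sigmaS_le (x := (Finset.Icc 1 k).sup' hne f) hk hβ hβ1 hT
    fun n hn => min_le_iff.1 (Finset.le_sup' f hn)) ?_
  exact (Finset.sup'_lt_iff hne).2 fun n hn => min_lt_iff.2 (h n hn)

theorem le_sigmaS {k : ℕ} (hk : 1 ≤ k) {β T x : ℝ} (hβ : 0 < β) (hβ1 : β ≤ 1) (hT : 0 < T)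
    (hlam : ∀ n, k ≤ n → x ≤ lamS n β T) (hmu : ∀ n, 1 ≤ n → x ≤ muS n β T) :
    x ≤ sigmaS β T (2 * k) := by
  refine le_csInf ?_ fun y hy => ?_
  · set f : ℕ → ℝ := fun n => lamS n β T
    refine ⟨(Finset.Icc 1 k).sup' ⟨1, by simp [hk]⟩ f, ?_⟩
    have hA : (Finset.Icc 1 k).card ≤ {n : ℕ | 1 ≤ n ∧ lamS n β T ≤
        (Finset.Icc 1 k).sup' ⟨1, by simp [hk]⟩ f}.ncard := by
      rw [← Set.ncard_coe_finset]
      refine Set.ncard_le_ncard (fun n hn => ?_) (finite_lamS_le hβ hβ1 hT _)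
      exact ⟨(Finset.mem_Icc.1 hn).1, Finset.le_sup' f hn⟩
    rw [Nat.card_Icc] at hA
    rw [Set.mem_ofPred_eq]
    omega
  · by_contra! hyx
    have h1 : {n : ℕ | 1 ≤ n ∧ lamS n β T ≤ y}.ncard ≤ k - 1 := by
      have : {n : ℕ | 1 ≤ n ∧ lamS n β T ≤ y} ⊆ Finset.Ico 1 k := fun n hn => by
        rw [Finset.mem_coe, Finset.mem_Ico]
        refine ⟨hn.1, ?_⟩
        by_contra! hkn
        linarith [hlam n hkn, hn.2]
      simpa using Set.ncard_le_ncard this (Finset.finite_toSet _)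
    have h2 : {n : ℕ | 1 ≤ n ∧ muS n β T ≤ y} = ∅ :=
      Set.eq_empty_of_forall_notMem fun n hn => by linarith [hmu n hn.1, hn.2]
    rw [Set.mem_ofPred_eq, h2, Set.ncard_empty] at hy
    split_ifs at hy <;> omega

theorem coth_mul_tanh {x : ℝ} (hx : 0 < x) : coth x * tanh x = 1 := by
  have hs : 0 < sinh x := sinh_pos_iff.2 hx
  have hc := cosh_pos x
  rw [coth, tanh_eq_sinh_div_cosh]
  field_simp

theorem strictMono_tanh : StrictMono tanh := by
  intro x y hxy
  rw [tanh_eq_sinh_div_cosh, tanh_eq_sinh_div_cosh, div_lt_div_iff₀ (cosh_pos x) (cosh_pos y)]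
  have := sinh_pos_iff.2 (sub_pos.2 hxy)
  rw [sinh_sub] at this
  linarith

theorem strictMonoOn_tanh_mul_tanh {k : ℕ} (hk : 1 ≤ k) :
    StrictMonoOn (fun t : ℝ => k * (tanh (k * t / 2) * tanh (t / 2))) (Set.Ici 0) := by
  intro s hs t _ hst
  have hk0 : (0 : ℝ) < k := by exact_mod_cast hk
  have hs0 : (0 : ℝ) ≤ s := hs
  have ht0 : 0 < t := hs0.trans_lt hst
  have h1 : tanh (s / 2) < tanh (t / 2) := strictMono_tanh (by linarith)
  have h2 : tanh (k * s / 2) < tanh (k * t / 2) := strictMono_tanh (by gcongr)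
  have h3 : 0 ≤ tanh (s / 2) := by
    simpa using strictMono_tanh.monotone (by positivity : 0 ≤ s / 2)
  have h4 : 0 < tanh (k * t / 2) := tanh_half_pos (by positivity)
  exact mul_lt_mul_of_pos_left (mul_lt_mul'' h2 h1 (by
    simpa using strictMono_tanh.monotone (by positivity : 0 ≤ k * s / 2)) h3) hk0

theorem mul_tanh_eq_coth_iff {k : ℕ} {t : ℝ} (ht : 0 < t) :
    k * tanh (k * t / 2) = coth (t / 2) ↔ k * (tanh (k * t / 2) * tanh (t / 2)) = 1 := by
  have h := coth_mul_tanh (by positivity : 0 < t / 2)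
  rw [← h, ← mul_assoc]
  exact (mul_left_inj' (tanh_half_pos ht).ne').symm

theorem existsUnique_mul_tanh_eq_coth {k : ℕ} (hk : 2 ≤ k) :
    ∃! t₀ : ℝ, 0 < t₀ ∧ (k : ℝ) * tanh (k * t₀ / 2) = coth (t₀ / 2) := by
  have hk2 : (2 : ℝ) ≤ k := by exact_mod_cast hk
  set f : ℝ → ℝ := fun t => k * (tanh (k * t / 2) * tanh (t / 2)) with hf
  have hmono : StrictMonoOn f (Set.Ici 0) := strictMonoOn_tanh_mul_tanh (by omega)
  have htanh : Continuous tanh := by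
    have : (tanh : ℝ → ℝ) = fun x => sinh x / cosh x := funext tanh_eq_sinh_div_cosh
    rw [this]
    exact continuous_sinh.div continuous_cosh fun x => (cosh_pos x).ne'
  have hcont : Continuous f := by fun_prop
  have h0 : f 0 = 0 := by simp [hf]
  have h4 : 1 ≤ f 4 := by
    have h1 : 1 / 2 ≤ tanh 2 ^ 2 := by
      have hs : (2 : ℝ) ≤ sinh 2 := self_le_sinh_iff.2 (by norm_num)
      have hc := cosh_sq (2 : ℝ)
      rw [tanh_eq_sinh_div_cosh, div_pow, le_div_iff₀ (by positivity)]
      nlinarith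
    have h2 : tanh 2 ≤ tanh (k * 4 / 2) := strictMono_tanh.monotone (by linarith)
    have h3 : 0 < tanh 2 := by simpa using strictMono_tanh (by norm_num : (0 : ℝ) < 2)
    have h5 : f 4 = k * (tanh (k * 4 / 2) * tanh 2) := by
      simp only [hf]
      norm_num
    rw [h5]
    nlinarith [mul_le_mul_of_nonneg_right h2 h3.le]
  obtain ⟨t, ht, hft⟩ := intermediate_value_Icc (by norm_num : (0 : ℝ) ≤ 4) hcont.continuousOn
    (show (1 : ℝ) ∈ Set.Icc (f 0) (f 4) from ⟨by rw [h0]; norm_num, h4⟩)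
  have ht0 : 0 < t := lt_of_le_of_ne ht.1 fun h => by
    rw [← h, h0] at hft
    norm_num at hft
  refine ⟨t, ⟨ht0, (mul_tanh_eq_coth_iff ht0).2 hft⟩, fun s hs => ?_⟩
  exact hmono.injOn hs.1.le ht0.le (((mul_tanh_eq_coth_iff hs.1).1 hs.2).trans hft.symm)

theorem two_mul_coth_sub_coth_eq {k : ℕ} (hk : 1 ≤ k) {t₀ m : ℝ} (ht₀ : 0 < t₀)
    (hm : m = k * tanh (k * t₀ / 2)) (hm' : m = coth (t₀ / 2)) :
    2 * m * (k * coth (k * t₀) - coth t₀) = (k : ℝ) ^ 2 - 1 := by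
  have hk0 : (0 : ℝ) < k := by exact_mod_cast hk
  have h1 := two_mul_coth_mul_tanh_half (by positivity : 0 < k * t₀)
  have h2 := two_mul_coth_mul_coth_half ht₀
  have h3 : 2 * m * (k * coth (k * t₀)) = (k : ℝ) ^ 2 + m ^ 2 := by
    rw [hm]
    linear_combination (k : ℝ) ^ 2 * h1
  rw [← hm'] at h2
  linear_combination h3 - h2

/-- Beyond the critical parameter, `λ̃_n` and `μ̃_{k+1-n}` are not both large. -/
theorem lamS_lt_or_muS_lt {k : ℕ} (hk : 2 ≤ k) {t₀ m β T : ℝ} (ht₀ : 0 < t₀)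
    (hm : m = k * tanh (k * t₀ / 2)) (hm' : m = coth (t₀ / 2))
    (hβ : 0 < β) (hβ1 : β ≤ 1) (hT : t₀ < T) {n : ℕ} (hn : n ∈ Finset.Icc 1 k) :
    lamS n β T < 4 * π * m ∨ muS (k + 1 - n) β T < 4 * π * m := by
  obtain ⟨hn1, hnk⟩ := Finset.mem_Icc.1 hn
  have hT0 := ht₀.trans hT
  have hk2 : (2 : ℝ) ≤ k := by exact_mod_cast hk
  have heq := two_mul_coth_sub_coth_eq (by omega) ht₀ hm hm'
  have hm1 : 1 < m := hm' ▸ one_lt_coth (by positivity)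
  have hmk : (k + 1 : ℝ) / 2 < m := by
    nlinarith [mul_coth_mul_sub_coth_lt hk ht₀]
  rw [or_iff_not_imp_left, not_lt]
  intro hlam
  have hmn : m < n := by
    have := hlam.trans_lt (lamS_lt_four_mul_pi_mul hn1 hβ hβ1 hT0)
    exact lt_of_mul_lt_mul_left this (by positivity)
  obtain ⟨l, hl⟩ : ∃ l, l = k + 1 - n := ⟨_, rfl⟩
  rw [← hl]
  have hl1 : 1 ≤ l := by omega
  have hl1' : (1 : ℝ) ≤ l := by exact_mod_cast hl1
  have hsum : (n : ℝ) + l = k + 1 := by exact_mod_cast (by omega : n + l = k + 1)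
  have hln : (l : ℝ) < n := by linarith
  have hq := quadratic_nonneg_of_le_lamS hn1 hβ hβ1 hT0 hlam
  refine muS_lt_of_quadratic_pos hl1 hβ hβ1 hT0 (by linarith) ?_
  have hslope := mul_coth_slope_le hT0 one_pos hl1' hln (a := k) (by linarith)
  rw [one_mul, one_mul] at hslope
  have hmono : k * coth (k * t₀) - coth t₀ < k * coth (k * T) - coth T :=
    strictMonoOn_mul_coth_mul_sub_coth hk ht₀ hT0 hT
  have hnl : 0 < (n : ℝ) - l := sub_pos.2 hln
  have h1 : (k : ℝ) ^ 2 - 1 < 2 * m * (k * coth (k * T) - coth T) := by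
    rw [← heq]
    gcongr
  have h2 : (k - 1 : ℝ) * ((n - l) * (k + 1)) <
      (k - 1) * (2 * m * (n * coth (n * T) - l * coth (l * T))) := by
    nlinarith [mul_lt_mul_of_pos_left h1 hnl,
      mul_le_mul_of_nonneg_left hslope (by linarith : 0 ≤ 2 * m)]
  have h3 := lt_of_mul_lt_mul_left h2 (by linarith)
  rw [← hsum] at h3
  nlinarith

theorem lamS_le {n : ℕ} (hn : 1 ≤ n) {β T : ℝ} (hβ : 0 < β) (hβ1 : β ≤ 1) (hT : 0 < T) :
    lamS n β T ≤ 4 * n * π * tanh (n * T / 2) := by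
  rcases hβ1.lt_or_eq with h | rfl
  · exact (lamS_lt_of_lt_one hn hβ h hT).le
  · exact (lamS_one hn hT).le

theorem mul_tanh_mono {n k : ℕ} (hnk : n ≤ k) {s t : ℝ} (hs : 0 < s) (hst : s ≤ t) :
    4 * n * π * tanh (n * s / 2) ≤ 4 * k * π * tanh (k * t / 2) := by
  have h : (n : ℝ) ≤ k := by exact_mod_cast hnk
  have ht : 0 ≤ tanh (n * s / 2) := by
    simpa using strictMono_tanh.monotone (by positivity : 0 ≤ n * s / 2)
  have h2 : tanh (n * s / 2) ≤ tanh (k * t / 2) := strictMono_tanh.monotone (by gcongr)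
  gcongr

theorem even_eigenvalue_sup (k : ℕ) (hk : 2 ≤ k) :
    (∃! t₀ : ℝ, 0 < t₀ ∧ (k : ℝ) * Real.tanh (k * t₀ / 2) = coth (t₀ / 2)) ∧
    ∀ t₀ : ℝ, 0 < t₀ → (k : ℝ) * Real.tanh (k * t₀ / 2) = coth (t₀ / 2) →
      ∀ β T : ℝ, 0 < β → β ≤ 1 → 0 < T →
        sigmaS β T (2 * k) ≤ 4 * k * π * Real.tanh (k * t₀ / 2) ∧
        (sigmaS β T (2 * k) = 4 * k * π * Real.tanh (k * t₀ / 2) ↔ β = 1 ∧ T = t₀) := by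
  refine ⟨existsUnique_mul_tanh_eq_coth hk, fun t₀ ht₀ heq β T hβ hβ1 hT => ?_⟩
  have hk0 : (0 : ℝ) < k := by exact_mod_cast (by omega : 0 < k)
  have hlt : ¬(β = 1 ∧ T = t₀) →
      sigmaS β T (2 * k) < 4 * k * π * Real.tanh (k * t₀ / 2) := by
    intro hne
    refine sigmaS_lt (by omega) hβ hβ1 hT fun n hn => ?_
    rcases lt_or_ge t₀ T with h | h
    · have := lamS_lt_or_muS_lt hk ht₀ rfl heq hβ hβ1 h hn
      rwa [show 4 * π * (k * tanh (k * t₀ / 2)) = 4 * k * π * tanh (k * t₀ / 2) by ring] at this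
    · left
      obtain ⟨hn1, hnk⟩ := Finset.mem_Icc.1 hn
      rcases hβ1.lt_or_eq with hβ' | rfl
      · exact (lamS_lt_of_lt_one hn1 hβ hβ' hT).trans_le (mul_tanh_mono hnk hT h)
      · have hTt : T < t₀ := lt_of_le_of_ne h fun h' => hne ⟨rfl, h'⟩
        refine (lamS_le hn1 hβ hβ1 hT).trans_lt
          ((mul_tanh_mono hnk hT le_rfl).trans_lt ?_)
        have : tanh (k * T / 2) < tanh (k * t₀ / 2) := strictMono_tanh (by gcongr)
        gcongr
  have hge : β = 1 ∧ T = t₀ → sigmaS β T (2 * k) = 4 * k * π * Real.tanh (k * t₀ / 2) := by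
    rintro ⟨rfl, rfl⟩
    refine le_antisymm (sigmaS_le (by omega) hβ hβ1 hT fun n hn => Or.inl ?_)
      (le_sigmaS (by omega) hβ hβ1 hT (fun n hn => ?_) fun n hn => ?_)
    · obtain ⟨hn1, hnk⟩ := Finset.mem_Icc.1 hn
      exact (lamS_le hn1 hβ hβ1 hT).trans (mul_tanh_mono hnk hT le_rfl)
    · rw [lamS_one (by omega) hT]
      exact mul_tanh_mono hn hT le_rfl
    · have h := coth_le_mul_coth_mul hn (by positivity : 0 < T / 2)
      rw [← mul_div_assoc] at h
      rw [muS_one hn hT]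
      nlinarith [mul_le_mul_of_nonneg_left (heq.trans_le h) (by positivity : 0 ≤ 4 * π)]
  by_cases h : β = 1 ∧ T = t₀
  · exact ⟨(hge h).le, fun _ => h, hge⟩
  · exact ⟨(hlt h).le, fun h' => absurd h' (hlt h).ne, hge⟩
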